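/- Let m ≥ 3 be odd, let z = (z_{i,j,k}) with 1 ≤ i < j ≤ m and 1 ≤ k ≤ d be new variables over R = k[x_1,…,x_d], set T = R[z], and let M be the m × m alternating matrix over T with (i,j)-entry p_{i,j} = x_1^D z_{i,j,1} + x_2^D z_{i,j,2} + … + x_d^D z_{i,j,d} for i < j (and M skew-symmetric with zero diagonal). Then for 1 ≤ t ≤ m-1, the grade of the ideal I_t(M) of t × t minors of M satisfies grade(I_t(M)) ≥ min{m+2-t, d} if t is even, and grade(I_t(M)) ≥ min{m+1-t, d} if t is odd. -/

import Mathlib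

open MvPolynomial

noncomputable section

set_option synthInstance.maxHeartbeats 1000000
set_option maxHeartbeats 1000000

/-- The ideal `I_t(M)` generated by the `t × t` minors of a square matrix `M`. -/
def minorsIdeal {A : Type*} [CommRing A] {n : ℕ} (t : ℕ) (M : Matrix (Fin n) (Fin n) A) :
    Ideal A :=
  Ideal.span {x | ∃ (r : Fin t → Fin n) (c : Fin t → Fin n), x = (M.submatrix r c).det}

/-- Multiplication by `a` is injective modulo the ideal `J`. -/
def RegularMod {A : Type*} [CommRing A] (J : Ideal A) (a : A) : Prop :=
  ∀ x, a * x ∈ J → x ∈ J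

/-- The list is a weakly regular sequence modulo the ideal `J`. -/
def RegularSeqMod {A : Type*} [CommRing A] : Ideal A → List A → Prop
  | _, [] => True
  | J, a :: L => RegularMod J a ∧ RegularSeqMod (J ⊔ Ideal.span {a}) L

section RegularSeqMod

variable {A : Type*} [CommRing A]

theorem RegularMod.one (J : Ideal A) : RegularMod J 1 := fun x hx => by simpa using hx

theorem RegularMod.mul {J : Ideal A} {a b : A} (ha : RegularMod J a) (hb : RegularMod J b) :
    RegularMod J (a * b) :=
  fun x hx => hb x (ha _ (by rwa [← mul_assoc]))

theorem RegularMod.pow {J : Ideal A} {a : A} (ha : RegularMod J a) (n : ℕ) :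
    RegularMod J (a ^ n) := by
  induction n with
  | zero => simpa using RegularMod.one J
  | succ n ih => rw [pow_succ]; exact ih.mul ha

theorem RegularMod.of_isUnit {J : Ideal A} {u : A} (hu : IsUnit u) : RegularMod J u :=
  fun _ hx => (Ideal.unit_mul_mem_iff_mem J hu).1 hx

theorem RegularMod.congr {J : Ideal A} {a b : A} (ha : RegularMod J a) (h : b - a ∈ J) :
    RegularMod J b := by
  intro x hx
  apply ha
  have := J.sub_mem hx (J.mul_mem_right x h)
  rwa [← sub_mul, sub_sub_cancel] at this

theorem regularSeqMod_append {J : Ideal A} {L₁ L₂ : List A} :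
    RegularSeqMod J (L₁ ++ L₂) ↔
      RegularSeqMod J L₁ ∧ RegularSeqMod (J ⊔ Ideal.ofList L₁) L₂ := by
  induction L₁ generalizing J with
  | nil => simp [RegularSeqMod]
  | cons a L ih => simp [RegularSeqMod, ih, and_assoc, sup_assoc]

theorem RegularSeqMod.isWeaklyRegular {L : List A} (h : RegularSeqMod ⊥ L) :
    RingTheory.Sequence.IsWeaklyRegular A L := by
  refine ⟨fun i hi => ?_⟩
  rw [isSMulRegular_quotient_iff_mem_of_smul_mem]
  rw [← List.take_append_drop i L, regularSeqMod_append, List.drop_eq_getElem_cons hi] at h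
  intro x hx
  simpa using h.2.1 x (by simpa using hx)

/-- Regular sequences lift along a retraction `φ` with kernel `J`. -/
theorem RegularSeqMod.sup_of_retraction (φ : A →+* A) {J : Ideal A} (hJ : ∀ x ∈ J, φ x = 0)
    (hφ : ∀ x, x - φ x ∈ J) {L : List A} (hL : ∀ a ∈ L, φ a = a) {I : Ideal A}
    (hI : I ≤ I.comap φ) (h : RegularSeqMod I L) : RegularSeqMod (J ⊔ I) L := by
  induction L generalizing I with
  | nil => trivial
  | cons a L ih =>
    refine ⟨fun x hx => ?_, ?_⟩
    · have h1 : J ⊔ I ≤ I.comap φ :=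
        sup_le (fun y hy => by simp [Ideal.mem_comap, hJ y hy]) hI
      have h2 : a * φ x ∈ I := by
        have := h1 hx
        rwa [Ideal.mem_comap, map_mul, hL a (by simp)] at this
      rw [← sub_add_cancel x (φ x)]
      exact add_mem (Ideal.mem_sup_left (hφ x)) (Ideal.mem_sup_right (h.1 _ h2))
    · rw [sup_assoc]
      refine ih (fun b hb => hL b (by simp [hb])) (sup_le ?_ ?_) h.2
      · exact hI.trans (Ideal.comap_mono le_sup_left)
      · rw [Ideal.span_le, Set.singleton_subset_iff]
        change φ a ∈ I ⊔ Ideal.span {a}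
        rw [hL a (by simp)]
        exact Ideal.mem_sup_right (Ideal.mem_span_singleton_self a)

/-- If an additive map `δ` divides by `b` and is linear over the generators of an ideal, then `b`
is regular modulo that ideal. -/
theorem RegularMod.of_division (δ : A →+ A) {S : Set A} {b : A} (hb : ∀ x, δ (b * x) = x)
    (hS : ∀ q ∈ S, ∀ x, δ (q * x) = q * δ x) : RegularMod (Ideal.span S) b := by
  have key : ∀ y ∈ Ideal.span S, ∀ a, δ (a * y) ∈ Ideal.span S := by
    intro y hy
    induction hy using Submodule.span_induction with
    | mem q hq =>
      intro a
      rw [mul_comm, hS q hq]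
      exact Ideal.mul_mem_right _ _ (Ideal.subset_span hq)
    | zero => intro a; simp
    | add y z _ _ hy hz => intro a; rw [mul_add, map_add]; exact add_mem (hy a) (hz a)
    | smul b y _ hy => intro a; rw [smul_eq_mul, ← mul_assoc]; exact hy _
  intro x hx
  simpa [hb] using key _ hx 1

end RegularSeqMod

section Graded

variable {A σ : Type*} [CommRing A] [SetLike σ A] [AddSubmonoidClass σ A] (𝒜 : ℕ → σ)
  [GradedRing 𝒜]

theorem Ideal.IsHomogeneous.mem_of_forall_mem_sup_pow {J : Ideal A} (hJ : J.IsHomogeneous 𝒜)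
    {a x : A} {e : ℕ} (he : 0 < e) (ha : a ∈ 𝒜 e)
    (hx : ∀ N : ℕ, x ∈ J ⊔ Ideal.span {a ^ N}) : x ∈ J := by
  rw [hJ.mem_iff]
  intro i
  obtain ⟨j, hj, z, hz, rfl⟩ := Submodule.mem_sup.1 (hx (i + 1))
  obtain ⟨y, rfl⟩ := Ideal.mem_span_singleton'.1 hz
  have : (DirectSum.decompose 𝒜 (y * a ^ (i + 1)) i : A) = 0 := by
    rw [mul_comm]
    refine DirectSum.coe_decompose_mul_of_left_mem_of_not_le 𝒜
      (SetLike.pow_mem_graded (i + 1) ha) ?_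
    rw [smul_eq_mul, not_le]
    nlinarith
  rw [DirectSum.decompose_add, DirectSum.add_apply, AddMemClass.coe_add, this, add_zero]
  exact (hJ.mem_iff 𝒜).1 hj i

theorem RegularMod.swap {J : Ideal A} (hJ : J.IsHomogeneous 𝒜)
    {a b : A} {e : ℕ} (he : 0 < e) (ha : a ∈ 𝒜 e) (h₁ : RegularMod J a)
    (h₂ : RegularMod (J ⊔ Ideal.span {a}) b) :
    RegularMod J b ∧ RegularMod (J ⊔ Ideal.span {b}) a := by
  have hb : RegularMod J b := by
    have key : ∀ (N : ℕ) (x : A), b * x ∈ J → x ∈ J ⊔ Ideal.span {a ^ N} := by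
      intro N
      induction N with
      | zero => intro x _; simp
      | succ N ih =>
        intro x hx
        obtain ⟨j, hj, z, hz, rfl⟩ := Submodule.mem_sup.1 (h₂ x (Ideal.mem_sup_left hx))
        obtain ⟨y, rfl⟩ := Ideal.mem_span_singleton'.1 hz
        have hy : b * y ∈ J := by
          apply h₁
          have := J.sub_mem hx (J.mul_mem_left b hj)
          convert this using 1
          ring
        obtain ⟨j', hj', z', hz', rfl⟩ := Submodule.mem_sup.1 (ih y hy)
        obtain ⟨y', rfl⟩ := Ideal.mem_span_singleton'.1 hz'
        rw [add_mul, ← add_assoc]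
        refine add_mem (Ideal.mem_sup_left (add_mem hj (J.mul_mem_right a hj')))
          (Ideal.mem_sup_right (Ideal.mem_span_singleton'.2 ⟨y', by ring⟩))
    exact fun x hx => hJ.mem_of_forall_mem_sup_pow 𝒜 he ha fun N => key N x hx
  refine ⟨hb, fun x hx => ?_⟩
  obtain ⟨j, hj, z, hz, hax⟩ := Submodule.mem_sup.1 hx
  obtain ⟨y, rfl⟩ := Ideal.mem_span_singleton'.1 hz
  have hy : y ∈ J ⊔ Ideal.span {a} := by
    apply h₂
    rw [show b * y = a * x - j by rw [← hax]; ring]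
    exact sub_mem (Ideal.mem_sup_right (Ideal.mem_span_singleton'.2 ⟨x, by ring⟩))
      (Ideal.mem_sup_left hj)
  obtain ⟨j', hj', z', hz', rfl⟩ := Submodule.mem_sup.1 hy
  obtain ⟨y', rfl⟩ := Ideal.mem_span_singleton'.1 hz'
  have hmem : x - y' * b ∈ J := by
    apply h₁
    rw [show a * (x - y' * b) = j + j' * b by rw [mul_sub, ← hax]; ring]
    exact add_mem hj (J.mul_mem_right _ hj')
  rw [← sub_add_cancel x (y' * b)]
  exact add_mem (Ideal.mem_sup_left hmem)
    (Ideal.mem_sup_right (Ideal.mem_span_singleton'.2 ⟨y', rfl⟩))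

theorem Ideal.IsHomogeneous.sup_span_singleton {J : Ideal A} (hJ : J.IsHomogeneous 𝒜)
    {a : A} {e : ℕ} (ha : a ∈ 𝒜 e) : (J ⊔ Ideal.span {a}).IsHomogeneous 𝒜 :=
  hJ.sup (Ideal.homogeneous_span 𝒜 _ fun x hx => by
    rw [Set.mem_singleton_iff] at hx; subst hx; exact ⟨e, ha⟩)

theorem RegularSeqMod.cons_of_concat {J : Ideal A} (hJ : J.IsHomogeneous 𝒜) {L : List A}
    (hL : ∀ a ∈ L, ∃ e, 0 < e ∧ a ∈ 𝒜 e) {b : A} (h : RegularSeqMod J (L ++ [b])) :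
    RegularSeqMod J (b :: L) := by
  induction L generalizing J with
  | nil => exact h
  | cons a L ih =>
    obtain ⟨e, he, ha⟩ := hL a (by simp)
    have h' := ih (hJ.sup_span_singleton 𝒜 ha) (fun c hc => hL c (by simp [hc])) h.2
    have hs := h.1.swap 𝒜 hJ he ha h'.1
    exact ⟨hs.1, hs.2, by rw [sup_right_comm]; exact h'.2⟩

/-- A sequence that is triangular, up to powers and units, with respect to a homogeneous regular
sequence (modulo further homogeneous elements `G`) is itself regular. -/
theorem RegularSeqMod.of_triangular {ι : Type*} {J : Ideal A} (hJ : J.IsHomogeneous 𝒜)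
    {G : List A} (hG : ∀ a ∈ G, ∃ e, 0 < e ∧ a ∈ 𝒜 e) (q f u : ι → A) (t : ℕ)
    (hq : ∀ i, ∃ e, 0 < e ∧ q i ∈ 𝒜 e) (hf : ∀ i, ∃ e, f i ∈ 𝒜 e) (hu : ∀ i, IsUnit (u i))
    {L : List ι}
    (hfq : ∀ L₁ i L₂, L = L₁ ++ i :: L₂ →
      f i - u i * q i ^ t ∈ Ideal.ofList (G ++ L₁.map q))
    (h : RegularSeqMod J (G ++ L.map q)) : RegularSeqMod J (L.reverse.map f) := by
  induction L using List.reverseRecOn generalizing J with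
  | nil => trivial
  | append_singleton L i ih =>
    rw [List.map_append, ← List.append_assoc, regularSeqMod_append] at h
    obtain ⟨e, he⟩ := hf i
    have hfi : RegularMod (J ⊔ Ideal.ofList (G ++ L.map q)) (f i) :=
      ((RegularMod.of_isUnit (hu i)).mul (h.2.1.pow t)).congr
        (Ideal.mem_sup_right (hfq L i [] rfl))
    have h' := RegularSeqMod.cons_of_concat 𝒜 hJ (L := G ++ L.map q) (b := f i)
      (fun a ha => by
        rcases List.mem_append.1 ha with ha | ha
        · exact hG a ha
        · obtain ⟨j, -, rfl⟩ := List.mem_map.1 ha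
          exact hq j)
      (regularSeqMod_append.2 ⟨h.1, hfi, trivial⟩)
    rw [List.reverse_append, List.reverse_singleton, List.singleton_append, List.map_cons]
    refine ⟨h'.1, ih (hJ.sup_span_singleton 𝒜 he) (fun L₁ j L₂ hL => ?_) h'.2⟩
    exact hfq L₁ j (L₂ ++ [i]) (by rw [hL]; simp)

end Graded

section Polynomial

variable {σ : Type*}

theorem regularMod_C_X_pow_mul_X {τ k ι : Type*} [Field k] (D : ℕ) (x : ι → τ) (w : ι → σ)
    (hx : Function.Injective x) (hw : Function.Injective w) {L : List ι} {i : ι} (hi : i ∉ L) :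
    RegularMod
      (Ideal.ofList (L.map fun j =>
        (C (X (x j)) ^ D * X (w j) : MvPolynomial σ (MvPolynomial τ k))))
      (C (X (x i)) ^ D * X (w i)) := by
  classical
  have hne : ∀ j ∈ L, j ≠ i := fun j hj h => hi (h ▸ hj)
  apply RegularMod.mul
  · apply RegularMod.pow
    let δ₀ : MvPolynomial τ k →+ MvPolynomial τ k :=
      { toFun := fun y => y.divMonomial (Finsupp.single (x i) 1)
        map_zero' := zero_divMonomial _
        map_add' := fun y z => add_divMonomial y z _ }
    let δ : MvPolynomial σ (MvPolynomial τ k) →+ MvPolynomial σ (MvPolynomial τ k) :=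
      { toFun := fun y => AddMonoidAlgebra.map δ₀ y
        map_zero' := by ext1 m; rw [coeff_addMonoidAlgebraMap]; simp
        map_add' := fun y z => by ext1 m; simp }
    have hδ : ∀ y m, coeff m (δ y) = δ₀ (coeff m y) := fun y m => rfl
    refine RegularMod.of_division δ (fun y => ?_) ?_
    · ext1 m
      rw [hδ, coeff_C_mul]
      exact X_mul_divMonomial _ _
    · rintro q hq y
      obtain ⟨j, hj, rfl⟩ := List.mem_map.1 hq
      have h₀ : ∀ z, δ₀ (X (x j) * z) = X (x j) * δ₀ z := by
        intro z
        have hxj : x j ≠ x i := fun h => hne j hj (hx h)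
        ext m
        change coeff (Finsupp.single (x i) 1 + m) _ = coeff m (_ * divMonomial _ _)
        rw [coeff_X_mul', coeff_X_mul', coeff_divMonomial]
        have : (x j ∈ (Finsupp.single (x i) 1 + m).support) ↔ x j ∈ m.support := by
          simp [hxj.symm]
        simp only [this]
        split_ifs with h
        · congr 1
          ext a
          have := Finsupp.mem_support_iff.1 h
          by_cases ha : a = x j
          · subst ha; simp [hxj.symm]
          · simp [Finsupp.single_apply, Ne.symm ha]
        · rfl
      have hD : ∀ (n : ℕ) z, δ₀ (X (x j) ^ n * z) = X (x j) ^ n * δ₀ z := by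
        intro n
        induction n with
        | zero => simp
        | succ n ih => intro z; rw [pow_succ, mul_assoc, mul_assoc, ih, h₀]
      ext1 m
      rw [hδ, ← C_pow, mul_assoc, mul_assoc, coeff_C_mul, coeff_C_mul, hD]
      congr 1
      rw [coeff_X_mul', coeff_X_mul', hδ]
      split_ifs <;> simp
  · let δ : MvPolynomial σ (MvPolynomial τ k) →+ MvPolynomial σ (MvPolynomial τ k) :=
      { toFun := fun y => y.divMonomial (Finsupp.single (w i) 1)
        map_zero' := zero_divMonomial _
        map_add' := fun y z => add_divMonomial y z _ }
    refine RegularMod.of_division δ (fun y => X_mul_divMonomial _ _) ?_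
    rintro q hq y
    obtain ⟨j, hj, rfl⟩ := List.mem_map.1 hq
    have hwj : w j ≠ w i := fun h => hne j hj (hw h)
    ext1 m
    change coeff (Finsupp.single (w i) 1 + m) _ = coeff m (_ * divMonomial _ _)
    rw [← C_pow, mul_assoc, mul_assoc, coeff_C_mul, coeff_C_mul, coeff_X_mul', coeff_X_mul',
      coeff_divMonomial]
    have : (w j ∈ (Finsupp.single (w i) 1 + m).support) ↔ w j ∈ m.support := by
      simp [hwj.symm]
    simp only [this]
    split_ifs with h
    · congr 2
      ext a
      have := Finsupp.mem_support_iff.1 h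
      by_cases ha : a = w j
      · subst ha; simp [hwj.symm]
      · simp [Finsupp.single_apply, Ne.symm ha]
    · rfl

/-- The substitution replacing the variables `X s` with `s ∈ l` by `h s`. -/
def substList {R : Type*} [CommRing R] (h : σ → MvPolynomial σ R) (l : List σ) :
    MvPolynomial σ R →ₐ[R] MvPolynomial σ R :=
  letI := Classical.decEq σ
  aeval fun s => if s ∈ l then h s else X s

section Substitution

variable {R : Type*} [CommRing R] (h : σ → MvPolynomial σ R)

theorem sub_substList_mem (l : List σ) (p : MvPolynomial σ R) :
    p - substList h l p ∈ Ideal.ofList (l.map fun s => X s - h s) := by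
  classical
  induction p using MvPolynomial.induction_on with
  | C a => simp [substList]
  | add p q hp hq => rw [map_add, add_sub_add_comm]; exact add_mem hp hq
  | mul_X p s hp =>
    have hs : X s - substList h l (X s) ∈ Ideal.ofList (l.map fun s => X s - h s) := by
      rw [substList, aeval_X]
      split_ifs with hs
      · exact Ideal.subset_span (List.mem_map.2 ⟨s, hs, rfl⟩)
      · simp
    rw [map_mul, show p * X s - substList h l p * substList h l (X s) =
      (p - substList h l p) * X s + substList h l p * (X s - substList h l (X s)) by ring]
    exact add_mem (Ideal.mul_mem_right _ _ hp) (Ideal.mul_mem_left _ _ hs)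

variable {h} {N : List σ}

theorem substList_apply_eq_zero (hN : ∀ s ∈ N, h s = 0 ∨ ∃ s' ∉ N, h s = X s')
    {l : List σ} (hl : l ⊆ N) {p : MvPolynomial σ R}
    (hp : p ∈ Ideal.ofList (l.map fun s => X s - h s)) : substList h l p = 0 := by
  classical
  have : Ideal.ofList (l.map fun s => X s - h s) ≤ RingHom.ker (substList h l) := by
    refine Ideal.span_le.2 fun q hq => ?_
    obtain ⟨s, hs, rfl⟩ := List.mem_map.1 hq
    have hX : substList h l (X s) = h s := by simp [substList, hs]
    rw [SetLike.mem_coe, RingHom.mem_ker, map_sub, hX]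
    rcases hN s (hl hs) with h0 | ⟨s', hs', h1⟩
    · simp [h0]
    · rw [h1, substList, aeval_X, if_neg fun h' => hs' (hl h'), sub_self]
  exact this hp

theorem regularSeqMod_X_sub [IsDomain R] (hN : ∀ s ∈ N, h s = 0 ∨ ∃ s' ∉ N, h s = X s')
    (hnodup : N.Nodup) :
    RegularSeqMod ⊥ (N.map fun s => X s - h s) := by
  classical
  have key : ∀ l₂ l₁ : List σ, l₁ ++ l₂ = N →
      RegularSeqMod (Ideal.ofList (l₁.map fun s => X s - h s)) (l₂.map fun s => X s - h s) := by
    intro l₂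
    induction l₂ with
    | nil => intro _ _; trivial
    | cons a l₂ ih =>
      intro l₁ hl
      have hl₁ : l₁ ⊆ N := hl ▸ List.subset_append_left _ _
      have haN : a ∈ N := hl ▸ by simp
      have ha : a ∉ l₁ := fun h' => by
        rw [← hl] at hnodup
        exact (List.nodup_append.1 hnodup).2.2 a h' a (by simp) rfl
      refine ⟨fun x hx => ?_, ?_⟩
      · have h0 := substList_apply_eq_zero hN hl₁ hx
        rw [map_mul] at h0
        have h1 : substList h l₁ (X a - h a) ≠ 0 := by
          rw [map_sub, sub_ne_zero]
          rcases hN a haN with h2 | ⟨s', hs', h2⟩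
          · simp [h2, substList, ha]
          · rw [h2, substList, aeval_X, aeval_X, if_neg ha, if_neg fun h' => hs' (hl₁ h')]
            intro h3
            exact hs' (X_injective h3 ▸ haN)
        have h2 := (mul_eq_zero.1 h0).resolve_left h1
        simpa [h2] using sub_substList_mem h l₁ x
      · have := ih (l₁ ++ [a]) (by simp [hl])
        rwa [List.map_append, Ideal.ofList_append, List.map_singleton, Ideal.ofList_singleton]
          at this
  simpa using key N [] rfl

end Substitution

theorem regularSeqMod_C_X_pow_mul_X {τ k ι : Type*} [Field k] (D : ℕ) (x : ι → τ) (w : ι → σ)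
    (hx : Function.Injective x) (hw : Function.Injective w) {L : List ι} (hL : L.Nodup) :
    RegularSeqMod ⊥
      (L.map fun j => (C (X (x j)) ^ D * X (w j) : MvPolynomial σ (MvPolynomial τ k))) := by
  have key : ∀ l₂ l₁ : List ι, l₁ ++ l₂ = L → RegularSeqMod
      (Ideal.ofList (l₁.map fun j =>
        (C (X (x j)) ^ D * X (w j) : MvPolynomial σ (MvPolynomial τ k))))
      (l₂.map fun j => C (X (x j)) ^ D * X (w j)) := by
    intro l₂
    induction l₂ with
    | nil => intro _ _; trivial
    | cons a l₂ ih =>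
      intro l₁ hl
      have ha : a ∉ l₁ := fun h' => by
        rw [← hl] at hL
        exact (List.nodup_append.1 hL).2.2 a h' a (by simp) rfl
      refine ⟨regularMod_C_X_pow_mul_X D x w hx hw ha, ?_⟩
      have := ih (l₁ ++ [a]) (by simp [hl])
      rwa [List.map_append, Ideal.ofList_append, List.map_singleton, Ideal.ofList_singleton]
        at this
  simpa using key L [] rfl

end Polynomial

section AntidiagonalRow

/-- The row index of the `u`-th chosen off-diagonal position on the antidiagonal `i + j = a` of an
`m × m` matrix. -/
def antidiagRow (m a u : ℕ) : ℕ :=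
  u + if a = m ∨ (Even a ∧ a ≤ 2 * u) then 1 else 0

theorem antidiagRow_strictMono (m a : ℕ) : StrictMono (antidiagRow m a) := by
  intro u v huv
  unfold antidiagRow
  split_ifs with h₁ h₂
  · omega
  · exact absurd (h₁.imp_right fun h => ⟨h.1, by omega⟩) h₂
  · omega
  · omega

theorem antidiagRow_bounds {m t a u : ℕ} (hm : Odd m) (ht : Even t) (htm : t < m)
    (hta : t ≤ a + 1) (ham : a ≤ m) (hu : u < t) :
    antidiagRow m a u < m ∧ antidiagRow m a u ≤ a ∧ a - antidiagRow m a u < m ∧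
      2 * antidiagRow m a u ≠ a := by
  obtain ⟨m', rfl⟩ := hm
  obtain ⟨t', rfl⟩ := ht
  unfold antidiagRow
  simp only [Nat.even_iff]
  split_ifs with h <;> omega

theorem two_mul_antidiagRow_zero_lt {m t a : ℕ} (hm : Odd m) (ht : Even t) (htm : t < m)
    (hta : t ≤ a + 1) (ht0 : 0 < t) : 2 * antidiagRow m a 0 < a := by
  obtain ⟨m', rfl⟩ := hm
  obtain ⟨t', rfl⟩ := ht
  unfold antidiagRow
  simp only [Nat.even_iff]
  split_ifs with h <;> omega

end AntidiagonalRow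

section Alternating

variable {k : Type*} [Field k] {d m : ℕ}

/-- The index set of the variables `z_{i,j,l}`. -/
abbrev AltVars (m d : ℕ) : Type := {pr : Fin m × Fin m // pr.1 < pr.2} × Fin d

/-- The polynomial ring `k[x][z]`. -/
abbrev AltRing (k : Type*) [Field k] (m d : ℕ) : Type _ :=
  MvPolynomial (AltVars m d) (MvPolynomial (Fin d) k)

/-- Substitution turning the generic alternating matrix into a Hankel-like banded one: variables on
the `c`-th antidiagonal with last index `c` become `X (w c)`, all others vanish. -/
def bandSubst (k : Type*) [Field k] {d m n : ℕ} (t : ℕ) (w : Fin n → AltVars m d)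
    (s : AltVars m d) : AltRing k m d :=
  if h : (s.2 : ℕ) < n ∧ (s.1.1.1 : ℕ) + s.1.1.2 + 1 = t + s.2 then X (w ⟨s.2, h.1⟩) else 0

theorem minorsIdeal_succ_le {A : Type*} [CommRing A] {m : ℕ} (t : ℕ)
    (M : Matrix (Fin m) (Fin m) A) : minorsIdeal (t + 1) M ≤ minorsIdeal t M := by
  refine Ideal.span_le.2 ?_
  rintro _ ⟨r, c, rfl⟩
  rw [Matrix.det_succ_row_zero]
  refine Ideal.sum_mem _ fun j _ => Ideal.mul_mem_left _ _ (Ideal.subset_span ?_)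
  exact ⟨r ∘ Fin.succ, c ∘ j.succAbove, rfl⟩

/-- The determinant of a matrix that is lower triangular modulo an ideal. -/
theorem det_sub_prod_mem {A : Type*} [CommRing A] {t : ℕ} {K : Ideal A}
    {M : Matrix (Fin t) (Fin t) A} {g : Fin t → A} (hM : ∀ u v, u < v → M u v ∈ K)
    (hg : ∀ u, M u u - g u ∈ K) : M.det - ∏ u, g u ∈ K := by
  rw [← Ideal.Quotient.eq, RingHom.map_det, Matrix.det_of_isLowerTriangular, map_prod]
  · exact Finset.prod_congr rfl fun u _ => Ideal.Quotient.eq.2 (hg u)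
  · exact fun u v huv => Ideal.Quotient.eq_zero_iff_mem.2 (hM u v huv)

theorem det_isHomogeneous {σ R : Type*} [CommRing R] {t : ℕ}
    {M : Matrix (Fin t) (Fin t) (MvPolynomial σ R)} (hM : ∀ i j, (M i j).IsHomogeneous 1) :
    M.det.IsHomogeneous t := by
  rw [Matrix.det_apply]
  refine IsHomogeneous.sum _ _ _ fun p _ => ?_
  have : (∏ i, M (p i) i).IsHomogeneous t := by
    simpa using IsHomogeneous.prod Finset.univ (fun i => M (p i) i) (fun _ => 1)
      fun i _ => hM _ _
  rcases Int.units_eq_one_or (Equiv.Perm.sign p) with h | h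
  · simpa [h] using this
  · simpa [h] using this.neg

theorem exists_isRegular_minorsIdeal_of_even {D t n : ℕ} (hodd : Odd m) (ht : Even t)
    (ht0 : 0 < t) (htm : t < m) (hnd : n ≤ d) (hn : n ≤ m + 2 - t)
    (M : Matrix (Fin m) (Fin m) (AltRing k m d))
    (hM : ∀ i j : Fin m, M i j =
      if h : i < j then
        ∑ l : Fin d, (C (X l)) ^ D * X (⟨(i, j), h⟩, l)
      else if h' : j < i then
        - ∑ l : Fin d, (C (X l)) ^ D * X (⟨(j, i), h'⟩, l)
      else 0) :
    ∃ rs : List (AltRing k m d), rs.length = n ∧ (∀ r ∈ rs, r ∈ minorsIdeal t M) ∧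
      RingTheory.Sequence.IsRegular (AltRing k m d) rs := by
  classical
  have hb : ∀ (c : Fin n) (u : Fin t), _ := fun c u =>
    antidiagRow_bounds (a := t - 1 + c) hodd ht htm (by omega) (by omega) u.2
  have hlt : ∀ c : Fin n, 2 * antidiagRow m (t - 1 + c) 0 < t - 1 + c := fun c =>
    two_mul_antidiagRow_zero_lt hodd ht htm (by omega) ht0
  let row : Fin n → Fin t → Fin m := fun c u => ⟨antidiagRow m (t - 1 + c) u, (hb c u).1⟩
  let col : Fin n → Fin t → Fin m := fun c u =>
    ⟨t - 1 + c - antidiagRow m (t - 1 + c) u, (hb c u).2.2.1⟩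
  have hsum : ∀ c u v, (row c u : ℕ) + col c v + antidiagRow m (t - 1 + c) v =
      t - 1 + c + antidiagRow m (t - 1 + c) u := fun c u v => by
    have := (hb c v).2.1
    simp only [row, col]
    omega
  have hw0 : ∀ c, row c ⟨0, ht0⟩ < col c ⟨0, ht0⟩ := fun c => by
    have := hlt c
    simp only [row, col, Fin.lt_def]
    omega
  let x : Fin n → Fin d := Fin.castLE hnd
  let w : Fin n → AltVars m d := fun c => (⟨(row c ⟨0, ht0⟩, col c ⟨0, ht0⟩), hw0 c⟩, x c)
  have hx : Function.Injective x := Fin.castLE_injective hnd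
  have hw : Function.Injective w := fun c c' h => hx (congrArg Prod.snd h)
  let h : AltVars m d → AltRing k m d := bandSubst k t w
  have hhw : ∀ c, h (w c) = X (w c) := fun c => by
    have h1 := hsum c ⟨0, ht0⟩ ⟨0, ht0⟩
    have h2 : ((w c).2 : ℕ) < n ∧ ((w c).1.1.1 : ℕ) + (w c).1.1.2 + 1 = t + (w c).2 := by
      refine ⟨c.2, ?_⟩
      simp only [w, x, Fin.val_castLE]
      omega
    simp only [h, bandSubst]
    rw [dif_pos h2]
    rfl
  let N : List (AltVars m d) := (Finset.univ.filter fun s => h s ≠ X s).toList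
  have hwN : ∀ c, w c ∉ N := fun c => by simp [N, hhw]
  have hN : ∀ s ∈ N, h s = 0 ∨ ∃ s' ∉ N, h s = X s' := fun s _ => by
    by_cases hs : (s.2 : ℕ) < n ∧ (s.1.1.1 : ℕ) + s.1.1.2 + 1 = t + s.2
    · exact Or.inr ⟨w ⟨s.2, hs.1⟩, hwN _, dif_pos hs⟩
    · exact Or.inl (dif_neg hs)
  let G : List (AltRing k m d) := N.map fun s => X s - h s
  have hG : ∀ s, X s - h s ∈ Ideal.ofList G := fun s => by
    by_cases hs : h s = X s
    · simp [hs]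
    · exact Ideal.subset_span (List.mem_map.2 ⟨s, by simpa [N] using hs, rfl⟩)
  let q : Fin n → AltRing k m d := fun c => C (X (x c)) ^ D * X (w c)
  let f : Fin n → AltRing k m d := fun c => (M.submatrix (row c) (col c)).det
  let ε : Fin m → Fin m → AltRing k m d := fun i j => if i < j then 1 else -1
  have hε : ∀ i j, IsUnit (ε i j) := fun i j => by
    simp only [ε]
    split_ifs
    · exact isUnit_one
    · exact IsUnit.neg (isUnit_one (M := AltRing k m d))
  let P : ∀ i j : Fin m, i < j → AltRing k m d := fun i j hij =>
    ∑ l : Fin d, C (X l) ^ D * h (⟨(i, j), hij⟩, l)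
  have hMP : ∀ {i j : Fin m} (hij : i < j), M i j - P i j hij ∈ Ideal.ofList G := by
    intro i j hij
    rw [hM, dif_pos hij, ← Finset.sum_sub_distrib]
    refine Ideal.sum_mem _ fun l _ => ?_
    rw [← mul_sub]
    exact Ideal.mul_mem_left _ _ (hG _)
  have hanti : ∀ i j, M j i = -M i j := by
    intro i j
    rw [hM j i, hM i j]
    rcases lt_trichotomy i j with hij | rfl | hij
    · rw [dif_neg hij.asymm, dif_pos hij, dif_pos hij]
    · simp
    · rw [dif_pos hij, dif_neg hij.asymm, dif_pos hij, neg_neg]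
  have hdiag : ∀ i, M i i = 0 := fun i => by simp [hM i i]
  have hPq : ∀ {i j : Fin m} (hij : i < j) (c : Fin n), (i : ℕ) + j + 1 = t + c →
      P i j hij = q c := by
    intro i j hij c hc
    rw [show q c = C (X (x c)) ^ D * h (⟨(i, j), hij⟩, x c) from ?_]
    · refine Finset.sum_eq_single (x c) (fun l _ hl => ?_) (by simp)
      have : ¬ ((l : ℕ) < n ∧ (i : ℕ) + j + 1 = t + l) := fun hl' => hl (Fin.ext (by
        simp only [x, Fin.val_castLE]; omega))
      simp only [h, bandSubst]
      rw [dif_neg this, mul_zero]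
    · simp only [h, bandSubst]
      rw [dif_pos ⟨c.2, hc⟩]
      rfl
  have hPK : ∀ {i j : Fin m} (hij : i < j) (c : Fin n) (K : Ideal (AltRing k m d)),
      (∀ b < c, q b ∈ K) → (i : ℕ) + j + 1 < t + c → P i j hij ∈ K := by
    intro i j hij c K hK hc
    by_cases hl : t ≤ (i : ℕ) + j + 1
    · have hb : (i : ℕ) + j + 1 - t < n := by omega
      rw [hPq hij ⟨(i : ℕ) + j + 1 - t, hb⟩ (by simp only; omega)]
      exact hK _ (Fin.lt_def.2 (by simp only; omega))
    · refine Ideal.sum_mem _ fun l _ => ?_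
      simp only [h, bandSubst]
      rw [dif_neg (by omega), mul_zero]
      exact K.zero_mem
  have hMK : ∀ (i j : Fin m) (c : Fin n) (K : Ideal (AltRing k m d)), Ideal.ofList G ≤ K →
      (∀ b < c, q b ∈ K) → (i : ℕ) + j + 1 < t + c → M i j ∈ K := by
    have key : ∀ (i j : Fin m) (_ : i < j) (c : Fin n) (K : Ideal (AltRing k m d)),
        Ideal.ofList G ≤ K → (∀ b < c, q b ∈ K) → (i : ℕ) + j + 1 < t + c → M i j ∈ K := by
      intro i j hij c K hGK hK hc
      rw [← sub_add_cancel (M i j) (P i j hij)]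
      exact add_mem (hGK (hMP hij)) (hPK hij c K hK hc)
    intro i j c K hGK hK hc
    rcases lt_trichotomy i j with hij | rfl | hij
    · exact key i j hij c K hGK hK hc
    · rw [hdiag]; exact K.zero_mem
    · rw [hanti]
      exact neg_mem (key j i hij c K hGK hK (by omega))
  have hMq : ∀ (i j : Fin m) (c : Fin n), i ≠ j → (i : ℕ) + j + 1 = t + c →
      M i j - ε i j * q c ∈ Ideal.ofList G := by
    intro i j c hne hc
    rcases lt_or_gt_of_ne hne with hij | hij
    · simpa [ε, hij, hPq hij c hc] using hMP hij
    · have := neg_mem (hMP hij)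
      rw [hPq hij c (by omega)] at this
      rw [hanti]
      simp only [ε, if_neg hij.asymm]
      convert this using 1
      ring
  let 𝒜 := homogeneousSubmodule (AltVars m d) (MvPolynomial (Fin d) k)
  let _ : GradedAlgebra 𝒜 := MvPolynomial.gradedAlgebra
  have hq1 : ∀ (l : Fin d) (s : AltVars m d),
      (C (X l) ^ D * X s : AltRing k m d).IsHomogeneous 1 := fun l s => by
    rw [← C_pow]
    simpa using (isHomogeneous_C (AltVars m d) ((X l : MvPolynomial (Fin d) k) ^ D)).mul
      (isHomogeneous_X _ s)
  have hM1 : ∀ i j, (M i j).IsHomogeneous 1 := by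
    intro i j
    rw [hM]
    split_ifs
    · exact IsHomogeneous.sum _ _ _ fun l _ => hq1 l _
    · exact (IsHomogeneous.sum _ _ _ fun l _ => hq1 l _).neg
    · exact isHomogeneous_zero _ _ _
  have hf1 : ∀ c, (f c).IsHomogeneous t := fun c => det_isHomogeneous fun i j => hM1 _ _
  have hfq : ∀ L₁ c L₂, List.finRange n = L₁ ++ c :: L₂ →
      f c - (∏ u, ε (row c u) (col c u)) * q c ^ t ∈ Ideal.ofList (G ++ L₁.map q) := by
    intro L₁ c L₂ hL
    set K := Ideal.ofList (G ++ L₁.map q) with hK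
    have hGK : Ideal.ofList G ≤ K := by
      rw [hK, Ideal.ofList_append]
      exact le_sup_left
    have hqK : ∀ b < c, q b ∈ K := by
      intro b hbc
      have hmem : b ∈ L₁ ++ c :: L₂ := hL ▸ List.mem_finRange b
      have hpw := List.pairwise_lt_finRange n
      rw [hL, List.pairwise_append, List.pairwise_cons] at hpw
      have hbL : b ∈ L₁ := by
        rcases List.mem_append.1 hmem with h' | h'
        · exact h'
        · rcases List.mem_cons.1 h' with rfl | h'
          · exact absurd hbc (lt_irrefl _)
          · exact absurd hbc (hpw.2.1.1 b h').asymm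
      exact Ideal.subset_span (List.mem_append_right _ (List.mem_map_of_mem hbL))
    have hprod : (∏ u, ε (row c u) (col c u)) * q c ^ t = ∏ u, ε (row c u) (col c u) * q c := by
      rw [← Fin.prod_const, ← Finset.prod_mul_distrib]
    rw [hprod]
    refine det_sub_prod_mem (fun u v huv => hMK _ _ c K hGK hqK ?_)
      fun u => hGK (hMq _ _ _ (fun he => ?_) ?_)
    · have h1 := hsum c u v
      have h2 := antidiagRow_strictMono m (t - 1 + c) (show (u : ℕ) < v from huv)
      omega
    · have := (hb c u).2
      have := congrArg Fin.val he
      simp only [row, col] at this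
      omega
    · have := hsum c u u
      omega
  have hGQ : RegularSeqMod ⊥ (G ++ (List.finRange n).map q) := by
    rw [regularSeqMod_append, bot_sup_eq]
    refine ⟨regularSeqMod_X_sub hN (Finset.nodup_toList _), ?_⟩
    rw [← sup_bot_eq (Ideal.ofList G)]
    refine RegularSeqMod.sup_of_retraction (substList h N : AltRing k m d →+* AltRing k m d)
      (fun y hy => substList_apply_eq_zero hN (List.Subset.refl _) hy)
      (fun y => sub_substList_mem h N y) ?_ bot_le
      (regularSeqMod_C_X_pow_mul_X D x w hx hw (List.nodup_finRange n))
    intro y hy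
    obtain ⟨c, -, rfl⟩ := List.mem_map.1 hy
    simp only [q, RingHom.coe_coe, substList, map_mul, map_pow, aeval_X, if_neg (hwN c)]
    rw [← algebraMap_eq, AlgHom.commutes]
  have hG1 : ∀ a ∈ G, ∃ e, 0 < e ∧ a ∈ 𝒜 e := by
    intro a ha
    obtain ⟨s, hs, rfl⟩ := List.mem_map.1 ha
    refine ⟨1, one_pos, sub_mem (isHomogeneous_X _ s) ?_⟩
    rcases hN s hs with h0 | ⟨s', -, h1⟩
    · rw [h0]; exact zero_mem _
    · rw [h1]; exact isHomogeneous_X _ s'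
  have hreg := RegularSeqMod.of_triangular 𝒜 (J := ⊥) (Ideal.IsHomogeneous.bot 𝒜) hG1 q f
    (fun c => ∏ u, ε (row c u) (col c u)) t (fun c => ⟨1, one_pos, hq1 _ _⟩)
    (fun c => ⟨t, hf1 c⟩) (fun c => IsUnit.prod_univ_iff.2 fun u => hε _ _) hfq hGQ
  refine ⟨(List.finRange n).reverse.map f, by simp, ?_, hreg.isWeaklyRegular, ?_⟩
  · intro r hr
    obtain ⟨c, -, rfl⟩ := List.mem_map.1 hr
    exact Ideal.subset_span ⟨row c, col c, rfl⟩
  · rw [smul_eq_mul, Ideal.mul_top]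
    intro htop
    have hle : Ideal.ofList ((List.finRange n).reverse.map f) ≤
        RingHom.ker (constantCoeff : AltRing k m d →+* _) := by
      refine Ideal.span_le.2 fun r hr => ?_
      obtain ⟨c, -, rfl⟩ := List.mem_map.1 hr
      exact (hf1 c).coeff_eq_zero (by simpa using ht0.ne)
    rw [← htop] at hle
    exact RingHom.ker_ne_top _ (top_le_iff.1 hle)

end Alternating

/-- **Lemma (grade bound for generic alternating pfaffian matrices).**
Let `m ≥ 3` be odd, let `z = (z_{ijl})`, `1 ≤ i < j ≤ m`, `1 ≤ l ≤ d`, be variables over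
`R = k[x_1, …, x_d]`, let `T = R[z]`, and let `M` be the `m × m` alternating matrix over `T`
with entries `p_{ij} = ∑_l x_l^D z_{ijl}` for `i < j`.  Then, for `1 ≤ t ≤ m-1`,
`grade I_t(M) ≥ min {m+2-t, d}` if `t` is even and `grade I_t(M) ≥ min {m+1-t, d}` if `t` is
odd;  i.e. `I_t(M)` contains a regular sequence of that length. -/
theorem grade_bound_generic_alternating_matrix
    (k : Type) [Field k] (d D m : ℕ) (hD : 1 ≤ D) (hm : 3 ≤ m) (hodd : Odd m)
    (M : Matrix (Fin m) (Fin m)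
      (MvPolynomial ({pr : Fin m × Fin m // pr.1 < pr.2} × Fin d) (MvPolynomial (Fin d) k)))
    (hM : ∀ i j : Fin m, M i j =
      if h : i < j then
        ∑ l : Fin d, (C (X l)) ^ D * X (⟨(i, j), h⟩, l)
      else if h' : j < i then
        - ∑ l : Fin d, (C (X l)) ^ D * X (⟨(j, i), h'⟩, l)
      else 0) :
    ∀ t : ℕ, 1 ≤ t → t ≤ m - 1 →
      ∃ rs : List
          (MvPolynomial ({pr : Fin m × Fin m // pr.1 < pr.2} × Fin d) (MvPolynomial (Fin d) k)),
        rs.length = (if Even t then min (m + 2 - t) d else min (m + 1 - t) d) ∧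
        (∀ r ∈ rs, r ∈ minorsIdeal t M) ∧
        RingTheory.Sequence.IsRegular
          (MvPolynomial ({pr : Fin m × Fin m // pr.1 < pr.2} × Fin d) (MvPolynomial (Fin d) k))
          rs := by
  intro t ht1 htm
  rcases Nat.even_or_odd t with ht | ht
  · rw [if_pos ht]
    exact exists_isRegular_minorsIdeal_of_even hodd ht (by omega) (by omega) (min_le_right _ _)
      (min_le_left _ _) M hM
  · rw [if_neg (Nat.not_even_iff_odd.2 ht)]
    have hlt : t + 1 < m := by
      obtain ⟨a, rfl⟩ := hodd
      obtain ⟨b, rfl⟩ := ht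
      omega
    obtain ⟨rs, hlen, hmem, hreg⟩ := exists_isRegular_minorsIdeal_of_even
      (n := min (m + 1 - t) d) hodd ht.add_one t.succ_pos hlt (min_le_right _ _)
      ((min_le_left _ _).trans (by omega)) M hM
    exact ⟨rs, hlen, fun r hr => minorsIdeal_succ_le t M (hmem r hr), hreg⟩

end
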